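/- Let R be a commutative ring that is a ℚ-algebra, A an associative unital R-algebra, X ∈ A a nilpotent element, and N a natural number with (ad X)^{N+1} = 0, where ad X : A → A is x ↦ X·x − x·X. Then for every d ∈ R with d² = 0 and every Y ∈ A, exp(X + d • Y) = exp(d • Σ_{p=0}^{N} (1/(p+1)!) • (ad X)ᵖ(Y)) · exp(X). (Paper: Theorem 5.6, the right logarithmic derivative of the exponential mapping, in its infinitesimal algebra form.) -/

import Mathlib

/-- The truncated exponential of a nilpotent element of an `R`-algebra,
where `R` is a commutative `ℚ`-algebra: `∑ₖ aᵏ/k!`, the sum being finite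
since `a` is nilpotent.  (For non-nilpotent `a` it takes a junk value.) -/
noncomputable def nilExp (R : Type*) {A : Type*} [CommRing R] [Algebra ℚ R]
    [Ring A] [Algebra R A] (a : A) : A :=
  ∑ k ∈ Finset.range (nilpotencyClass a), (((k.factorial : ℚ))⁻¹ • (1 : R)) • a ^ k

/-- The commutator bracket `[a, b] = a * b - b * a` in an associative ring. -/
def br {A : Type*} [Ring A] (a b : A) : A := a * b - b * a

section Helpers

variable {R A : Type*} [CommRing R] [Algebra ℚ R] [Ring A] [Algebra R A]

/-- The inverse factorial in `R`. -/
noncomputable def cf (R : Type*) [CommRing R] [Algebra ℚ R] (n : ℕ) : R :=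
  ((n.factorial : ℚ))⁻¹ • (1 : R)

theorem cf_zero : cf R 0 = 1 := by simp [cf]

theorem cf_succ (n : ℕ) : ((n : R) + 1) * cf R (n + 1) = cf R n := by
  have h : ((n : R) + 1) = algebraMap ℚ R ((n : ℚ) + 1) := by simp
  have h2 : ((n : ℚ) + 1) * ((n + 1).factorial : ℚ)⁻¹ = (n.factorial : ℚ)⁻¹ := by
    have := Nat.factorial_ne_zero n
    have h3 : (n : ℚ) + 1 ≠ 0 := by positivity
    rw [Nat.factorial_succ]; push_cast; field_simp
  rw [cf, cf, Algebra.smul_def, Algebra.smul_def, mul_one, mul_one, h, ← map_mul, h2]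

theorem exists_inv (n : ℕ) : ∃ r : R, r * ((n : R) + 1) = 1 := by
  refine ⟨algebraMap ℚ R (((n : ℚ) + 1)⁻¹), ?_⟩
  have h : ((n : R) + 1) = algebraMap ℚ R ((n : ℚ) + 1) := by simp
  have h3 : (n : ℚ) + 1 ≠ 0 := by positivity
  rw [h, ← map_mul, inv_mul_cancel₀ h3, map_one]

theorem smul_cancel (n : ℕ) {a b : A} (h : ((n : R) + 1) • a = ((n : R) + 1) • b) : a = b := by
  obtain ⟨r, hr⟩ := exists_inv (R := R) n
  rw [← one_smul R a, ← one_smul R b, ← hr, mul_smul, mul_smul, h]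

theorem cf_smul_cancel (n : ℕ) {a : A} (h : cf R n • a = 0) : a = 0 := by
  induction n with
  | zero => simpa [cf_zero] using h
  | succ n ih =>
    apply ih
    rw [← cf_succ, mul_smul, h, smul_zero]

theorem nilExp_eq_sum {a : A} {k : ℕ} (h : a ^ k = 0) :
    nilExp R a = ∑ i ∈ Finset.range k, cf R i • a ^ i := by
  have hle : nilpotencyClass a ≤ k := csInf_le' h
  refine Finset.sum_subset (Finset.range_mono hle) ?_
  intro i _ hi
  rw [pow_eq_zero_of_le (not_lt.1 (fun h' => hi (Finset.mem_range.2 h')))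
    (pow_nilpotencyClass ⟨k, h⟩), smul_zero]

/-- Divided iterated bracket. -/
noncomputable def ff (R : Type*) {A : Type*} [CommRing R] [Algebra ℚ R] [Ring A] [Algebra R A]
    (X Y : A) (p : ℕ) : A := cf R (p + 1) • (fun x => X * x - x * X)^[p] Y

/-- Divided power. -/
noncomputable def ee (R : Type*) {A : Type*} [CommRing R] [Algebra ℚ R] [Ring A] [Algebra R A]
    (X : A) (p : ℕ) : A := cf R p • X ^ p

theorem ee_succ (X : A) (q : ℕ) : X * ee R X q = ((q : R) + 1) • ee R X (q + 1) := by
  rw [ee, ee, smul_smul, cf_succ, mul_smul_comm, pow_succ']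

theorem X_ff (X Y : A) (p : ℕ) :
    X * ff R X Y p = ((p : R) + 2) • ff R X Y (p + 1) + ff R X Y p * X := by
  have h := cf_succ (R := R) (p + 1)
  have h' : ((p + 1 : ℕ) : R) + 1 = (p : R) + 2 := by push_cast; ring
  rw [h'] at h
  rw [ff, ff, smul_smul, h, Function.iterate_succ_apply']
  simp only [smul_sub, mul_smul_comm, smul_mul_assoc]
  abel

theorem ff_zero (X Y : A) : ff R X Y 0 = Y := by
  have := cf_succ (R := R) 0
  simp only [Nat.cast_zero, zero_add, one_mul, cf_zero] at this
  simp [ff, this]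

/-- Convolution. -/
noncomputable def tt (R : Type*) {A : Type*} [CommRing R] [Algebra ℚ R] [Ring A] [Algebra R A]
    (X Y : A) (n : ℕ) : A :=
  ∑ ij ∈ Finset.HasAntidiagonal.antidiagonal n, ff R X Y ij.1 * ee R X ij.2

theorem tt_succ (X Y : A) (n : ℕ) :
    (((n + 1 : ℕ) : R) + 1) • tt R X Y (n + 1) = X * tt R X Y n + Y * ee R X (n + 1) := by
  have h1 : (((n + 1 : ℕ) : R) + 1) • tt R X Y (n + 1)
      = ∑ ij ∈ Finset.HasAntidiagonal.antidiagonal (n + 1), ((ij.1 : R) + 1) • (ff R X Y ij.1 * ee R X ij.2)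
      + ∑ ij ∈ Finset.HasAntidiagonal.antidiagonal (n + 1), (ij.2 : R) • (ff R X Y ij.1 * ee R X ij.2) := by
    rw [tt, Finset.smul_sum, ← Finset.sum_add_distrib]
    refine Finset.sum_congr rfl fun ij hij => ?_
    rw [← add_smul, ← Finset.HasAntidiagonal.mem_antidiagonal.1 hij]
    congr 1
    push_cast; ring
  rw [h1, Finset.Nat.sum_antidiagonal_succ, Finset.Nat.sum_antidiagonal_succ', tt, Finset.mul_sum]
  have h2 : ∀ ij ∈ Finset.HasAntidiagonal.antidiagonal n, X * (ff R X Y ij.1 * ee R X ij.2)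
      = (((ij.1 + 1 : ℕ) : R) + 1) • (ff R X Y (ij.1 + 1) * ee R X ij.2)
        + ((ij.2 + 1 : ℕ) : R) • (ff R X Y ij.1 * ee R X (ij.2 + 1)) := by
    intro ij _
    rw [← mul_assoc, X_ff, add_mul, mul_assoc _ X, ee_succ, mul_smul_comm, smul_mul_assoc]
    push_cast
    congr 2
    ring
  rw [Finset.sum_congr rfl h2, Finset.sum_add_distrib]
  simp only [ff_zero, Nat.cast_zero, zero_add, one_smul, zero_smul]
  abel

theorem pow_formula (X Y : A) (d : R) (hd : d ^ 2 = 0) (n : ℕ) :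
    cf R (n + 1) • (X + d • Y) ^ (n + 1) = ee R X (n + 1) + d • tt R X Y n := by
  induction n with
  | zero =>
    have := cf_succ (R := R) 0
    simp only [Nat.cast_zero, zero_add, one_mul, cf_zero] at this
    simp [ee, tt, ff_zero, this, cf_zero]
  | succ n ih =>
    apply smul_cancel (R := R) (n + 1)
    rw [smul_smul, cf_succ, pow_succ', ← mul_smul_comm, ih, smul_add, ← ee_succ,
      smul_comm _ d, tt_succ]
    have hdd : d * d = 0 := by rw [← pow_two, hd]
    simp only [add_mul, mul_add, smul_mul_assoc, mul_smul_comm, smul_smul, hdd, zero_smul,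
      smul_add, add_zero]
    abel

theorem tt_sum (X Y : A) (N M K : ℕ) (hf : ∀ p, N < p → ff R X Y p = 0)
    (he : ∀ q, M ≤ q → ee R X q = 0) (hK : N + M ≤ K) :
    ∑ n ∈ Finset.range K, tt R X Y n
      = (∑ p ∈ Finset.range (N + 1), ff R X Y p) * ∑ q ∈ Finset.range M, ee R X q := by
  rw [Finset.sum_mul_sum, ← Finset.sum_product']
  rw [← Finset.sum_fiberwise_of_maps_to (t := Finset.range K) (g := fun ij : ℕ × ℕ => ij.1 + ij.2)]
  · refine Finset.sum_congr rfl fun n _ => ?_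
    rw [tt]
    symm
    refine Finset.sum_subset ?_ ?_
    · intro ij h
      simp only [Finset.mem_filter] at h
      exact Finset.HasAntidiagonal.mem_antidiagonal.2 h.2
    · intro ij h1 h2
      simp only [Finset.mem_filter, Finset.mem_product, Finset.mem_range,
        Finset.HasAntidiagonal.mem_antidiagonal] at h1 h2
      by_cases hp : N < ij.1
      · rw [hf _ hp, zero_mul]
      · rw [he _ (by by_contra h3; exact h2 ⟨⟨by omega, by omega⟩, h1⟩), mul_zero]
  · intro ij h
    simp only [Finset.mem_product, Finset.mem_range] at h ⊢
    omega

end Helpers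

theorem exp_add_infinitesimal_right {R A : Type*} [CommRing R] [Algebra ℚ R]
    [Ring A] [Algebra R A] (X : A) (hX : IsNilpotent X) (N : ℕ)
    (hN : ∀ z : A, (fun x => X * x - x * X)^[N + 1] z = 0)
    (d : R) (hd : d ^ 2 = 0) (Y : A) :
    nilExp R (X + d • Y) =
      nilExp R (d • ∑ p ∈ Finset.range (N + 1),
        (((1 / (p + 1).factorial : ℚ) • (1 : R)) •
          (fun x => X * x - x * X)^[p] Y)) *
        nilExp R X := by
  obtain ⟨M, hM⟩ := hX
  have hf : ∀ p, N < p → ff R X Y p = 0 := by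
    intro p hp
    obtain ⟨k, rfl⟩ := Nat.exists_eq_add_of_lt hp
    rw [ff, show N + k + 1 = (N + 1) + k by ring, Function.iterate_add_apply, hN, smul_zero]
  have he : ∀ q, M ≤ q → ee R X q = 0 := by
    intro q hq
    rw [ee, pow_eq_zero_of_le hq hM, smul_zero]
  have hsum : (∑ p ∈ Finset.range (N + 1), (((1 / (p + 1).factorial : ℚ) • (1 : R)) •
          (fun x => X * x - x * X)^[p] Y)) = ∑ p ∈ Finset.range (N + 1), ff R X Y p := by
    refine Finset.sum_congr rfl fun p _ => ?_
    rw [ff, cf, one_div]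
  rw [hsum]
  have hsq : (d • ∑ p ∈ Finset.range (N + 1), ff R X Y p) ^ 2 = 0 := by
    rw [smul_pow, hd, zero_smul]
  have htt : tt R X Y (N + M) = 0 := by
    refine Finset.sum_eq_zero fun ij h => ?_
    rw [Finset.HasAntidiagonal.mem_antidiagonal] at h
    by_cases hp : N < ij.1
    · rw [hf _ hp, zero_mul]
    · rw [he _ (by omega), mul_zero]
  have hnil : (X + d • Y) ^ (N + M + 1) = 0 := by
    apply cf_smul_cancel (R := R) (N + M + 1)
    rw [pow_formula X Y d hd, htt, he _ (by omega), smul_zero, add_zero]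
  have hc1 : cf R 1 = 1 := by
    have := cf_succ (R := R) 0
    simpa only [Nat.cast_zero, zero_add, one_mul, cf_zero] using this
  have hX1 : nilExp R X = ∑ q ∈ Finset.range M, ee R X q := nilExp_eq_sum hM
  have hX2 : nilExp R X = ∑ q ∈ Finset.range (N + M + 1), ee R X q :=
    nilExp_eq_sum (pow_eq_zero_of_le (show M ≤ N + M + 1 by omega) hM)
  rw [nilExp_eq_sum hsq, nilExp_eq_sum hnil, Finset.sum_range_succ',
    Finset.sum_congr rfl (fun n _ => pow_formula X Y d hd n), Finset.sum_add_distrib,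
    ← Finset.smul_sum, tt_sum X Y N M (N + M) hf he le_rfl, ← hX1]
  simp only [Finset.sum_range_succ, Finset.sum_range_zero, zero_add, pow_zero, pow_one, cf_zero,
    hc1, one_smul, add_mul, one_mul, smul_mul_assoc]
  rw [Finset.sum_range_succ'] at hX2
  have h0 : ee R X 0 = 1 := by simp [ee, cf_zero]
  rw [h0] at hX2
  nth_rw 3 [hX2]
  abel
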